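/- There exist absolute constants C, c₁, c₂ > 0 with the following property. Let ε ∈ (0, 1/100), let β ≥ C·ε^{-2}·log(1/ε), let G = (V,E) be a finite simple graph, let H ⊆ E be an EDBS of G with parameter β (deg_H(e) ≤ β for every e ∈ H), and let U = {e ∈ E ∖ H : deg_H(e) < (1−ε)·β} be the set of underfull edges. Then either μ(G) ≤ (c₁/ε)·μ(H) or μ(G) ≤ (1 + c₂·ε)·μ(H ∪ U). -/

import Mathlib

open Finset
open scoped Classical

/-- The degree of a vertex `v` in an edge set `H`: the number of edges of `H` incident to `v`. -/
noncomputable def degV {V : Type*} (H : Finset (Sym2 V)) (v : V) : ℕ :=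
  (H.filter (fun e => v ∈ e)).card

/-- The edge degree of an unordered pair `e = {u,w}` in an edge set `H`:
`deg_H(u) + deg_H(w)`. -/
noncomputable def degE {V : Type*} (H : Finset (Sym2 V)) (e : Sym2 V) : ℕ :=
  Sym2.lift ⟨fun u w => degV H u + degV H w, fun _ _ => add_comm _ _⟩ e

/-- `M` is a matching: its edges are non-loops and pairwise vertex-disjoint. -/
def IsMatching {V : Type*} (M : Finset (Sym2 V)) : Prop :=
  (∀ e ∈ M, ¬ e.IsDiag) ∧ ∀ e ∈ M, ∀ f ∈ M, e ≠ f → ∀ v : V, v ∈ e → v ∉ f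

/-- `matchNum F` = μ(F), the maximum size of a matching contained in the edge set `F`. -/
noncomputable def matchNum {V : Type*} (F : Finset (Sym2 V)) : ℕ :=
  F.powerset.sup (fun M => if IsMatching M then M.card else 0)

theorem degE_eq_sum_toFinset {V : Type*} (H : Finset (Sym2 V)) {e : Sym2 V} (he : ¬ e.IsDiag) :
    degE H e = ∑ v ∈ e.toFinset, degV H v := by
  induction e using Sym2.ind with
  | _ u w =>
    have huw : u ≠ w := by simpa using he
    rw [Sym2.toFinset_mk_eq, Finset.sum_pair huw]
    rfl

theorem sum_degV_le_two_mul_card {V : Type*} (H : Finset (Sym2 V)) (S : Finset V) :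
    ∑ v ∈ S, degV H v ≤ 2 * H.card := by
  calc ∑ v ∈ S, degV H v = ∑ e ∈ H, (S.filter (fun v => v ∈ e)).card :=
        Finset.sum_card_bipartiteAbove_eq_sum_card_bipartiteBelow (fun v e => v ∈ e)
    _ ≤ ∑ _e ∈ H, 2 := by
        refine Finset.sum_le_sum fun e _ => ?_
        have hsub : S.filter (fun v => v ∈ e) ⊆ e.toFinset := fun v hv => by
          simpa using (Finset.mem_filter.mp hv).2
        refine (Finset.card_le_card hsub).trans ?_
        rw [Sym2.card_toFinset]
        split_ifs <;> omega
    _ = 2 * H.card := by rw [Finset.sum_const, smul_eq_mul, mul_comm]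

theorem IsMatching.subset {V : Type*} {M N : Finset (Sym2 V)} (hM : IsMatching M) (h : N ⊆ M) :
    IsMatching N :=
  ⟨fun e he => hM.1 e (h he), fun e he f hf => hM.2 e (h he) f (h hf)⟩

theorem IsMatching.sum_degE_le {V : Type*} {M : Finset (Sym2 V)} (hM : IsMatching M)
    (H : Finset (Sym2 V)) : ∑ e ∈ M, degE H e ≤ 2 * H.card := by
  rw [Finset.sum_congr rfl fun e he => degE_eq_sum_toFinset H (hM.1 e he),
    ← Finset.sum_biUnion]
  · exact sum_degV_le_two_mul_card H _
  · intro e he f hf hef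
    rw [Function.onFun, Finset.disjoint_left]
    intro v hv hv'
    exact hM.2 e he f hf hef v (by simpa using hv) (by simpa using hv')

theorem IsMatching.card_le_matchNum {V : Type*} {M F : Finset (Sym2 V)} (hM : IsMatching M)
    (h : M ⊆ F) : M.card ≤ matchNum F := by
  have := Finset.le_sup (f := fun M : Finset (Sym2 V) => if IsMatching M then M.card else 0)
    (Finset.mem_powerset.mpr h)
  simp only [if_pos hM] at this
  exact this

theorem exists_isMatching_card_eq_matchNum {V : Type*} (F : Finset (Sym2 V)) :
    ∃ M ⊆ F, IsMatching M ∧ M.card = matchNum F := by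
  obtain ⟨M, hM, hsup⟩ := Finset.exists_mem_eq_sup F.powerset ⟨∅, by simp⟩
    (fun M => if IsMatching M then M.card else 0)
  by_cases h : IsMatching M
  · exact ⟨M, Finset.mem_powerset.mp hM, h, by rw [matchNum, hsup, if_pos h]⟩
  · exact ⟨∅, by simp, ⟨by simp, by simp⟩, by rw [matchNum, hsup, if_neg h, Finset.card_empty]⟩

/-- Every edge of `H` meets a maximum matching of `H`, so an edge degree bound `β` gives
`|H| ≤ β · μ(H)`. -/
theorem card_le_mul_matchNum {V : Type*} {H : Finset (Sym2 V)} {β : ℝ}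
    (hdiag : ∀ e ∈ H, ¬ e.IsDiag) (hβ : ∀ e ∈ H, (degE H e : ℝ) ≤ β) :
    (H.card : ℝ) ≤ β * matchNum H := by
  obtain ⟨N, hNH, hN, hcard⟩ := exists_isMatching_card_eq_matchNum H
  have hcover : ∀ f ∈ H, ∃ e ∈ N, ∃ v ∈ e, v ∈ f := by
    intro f hf
    by_contra! hcon
    have hfN : f ∉ N := fun h => by
      induction f using Sym2.ind with
      | _ u w => exact hcon _ h u (Sym2.mem_mk_left u w) (Sym2.mem_mk_left u w)
    have hins : IsMatching (insert f N) := by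
      refine ⟨fun e he => hdiag e (Finset.insert_subset hf hNH he), ?_⟩
      intro e he g hg heg v hve hvg
      rcases Finset.mem_insert.mp he with rfl | heN <;>
        rcases Finset.mem_insert.mp hg with rfl | hgN
      · exact heg rfl
      · exact hcon g hgN v hvg hve
      · exact hcon e heN v hve hvg
      · exact hN.2 e heN g hgN heg v hve hvg
    have := hins.card_le_matchNum (Finset.insert_subset hf hNH)
    rw [Finset.card_insert_of_notMem hfN] at this
    omega
  have hsum : H.card ≤ ∑ e ∈ N, degE H e := by
    have hsub : H ⊆ N.biUnion fun e => e.toFinset.biUnion fun v => H.filter (fun f => v ∈ f) := by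
      intro f hf
      obtain ⟨e, he, v, hve, hvf⟩ := hcover f hf
      simp only [Finset.mem_biUnion, Finset.mem_filter, Sym2.mem_toFinset]
      exact ⟨e, he, v, hve, hf, hvf⟩
    refine (Finset.card_le_card hsub).trans (Finset.card_biUnion_le.trans ?_)
    refine Finset.sum_le_sum fun e he => ?_
    rw [degE_eq_sum_toFinset H (hN.1 e he)]
    exact Finset.card_biUnion_le
  calc (H.card : ℝ) ≤ ∑ e ∈ N, (degE H e : ℝ) := by exact_mod_cast hsum
    _ ≤ ∑ _e ∈ N, β := Finset.sum_le_sum fun e he => hβ e (hNH he)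
    _ = β * matchNum H := by rw [Finset.sum_const, nsmul_eq_mul, hcard, mul_comm]

/-- general-graph dichotomy — there are absolute constants C, c₁, c₂ > 0
such that either μ(G) ≤ (c₁/ε)·μ(H) or μ(G) ≤ (1 + c₂·ε)·μ(H ∪ U). -/
theorem general_dichotomy :
    ∃ C c₁ c₂ : ℝ, 0 < C ∧ 0 < c₁ ∧ 0 < c₂ ∧
      ∀ (V : Type) (ε β : ℝ), ε ∈ Set.Ioo (0 : ℝ) (1/100) →
        C * ε⁻¹ ^ 2 * Real.log (1/ε) ≤ β →
        ∀ (E H U : Finset (Sym2 V)), (∀ e ∈ E, ¬ e.IsDiag) → H ⊆ E →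
          (∀ e ∈ H, (degE H e : ℝ) ≤ β) →
          U = E.filter (fun e => e ∉ H ∧ (degE H e : ℝ) < (1 - ε) * β) →
          ((matchNum E : ℝ) ≤ c₁ / ε * matchNum H ∨
            (matchNum E : ℝ) ≤ (1 + c₂ * ε) * matchNum (H ∪ U)) := by
  refine ⟨1, 3, 2, one_pos, by norm_num, by norm_num, ?_⟩
  rintro V ε β ⟨hε0, hε1⟩ hβ E H U hE hHE hH rfl
  have hβ0 : 0 < β := by
    refine lt_of_lt_of_le ?_ hβ
    have : 0 < Real.log (1 / ε) := Real.log_pos (by rw [lt_div_iff₀ hε0]; linarith)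
    positivity
  set U := E.filter (fun e => e ∉ H ∧ (degE H e : ℝ) < (1 - ε) * β) with hU
  obtain ⟨M, hME, hM, hcard⟩ := exists_isMatching_card_eq_matchNum E
  have hsplit := Finset.card_filter_add_card_filter_not (s := M) (fun e => e ∈ H ∪ U)
  have hin : (M.filter (fun e => e ∈ H ∪ U)).card ≤ matchNum (H ∪ U) :=
    (hM.subset (Finset.filter_subset _ _)).card_le_matchNum
      fun e he => (Finset.mem_filter.mp he).2
  set R := M.filter (fun e => e ∉ H ∪ U) with hR
  have hRdeg : ∀ e ∈ R, (1 - ε) * β ≤ (degE H e : ℝ) := by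
    intro e he
    obtain ⟨heM, heHU⟩ := Finset.mem_filter.mp he
    by_contra! hlt
    rw [Finset.mem_union, not_or] at heHU
    exact heHU.2 (Finset.mem_filter.mpr ⟨hME heM, heHU.1, hlt⟩)
  have hRsum : (R.card : ℝ) * ((1 - ε) * β) ≤ 2 * H.card := by
    calc (R.card : ℝ) * ((1 - ε) * β) = ∑ _e ∈ R, (1 - ε) * β := by
          rw [Finset.sum_const, nsmul_eq_mul]
      _ ≤ ∑ e ∈ R, (degE H e : ℝ) := Finset.sum_le_sum hRdeg
      _ ≤ 2 * H.card := by
          exact_mod_cast (hM.subset (Finset.filter_subset _ _)).sum_degE_le H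
  have hHcard := card_le_mul_matchNum (fun e he => hE e (hHE he)) hH
  have hRle : (R.card : ℝ) * (1 - ε) ≤ 2 * matchNum H := by
    refine le_of_mul_le_mul_right ?_ hβ0
    linarith
  have hRle3 : (R.card : ℝ) ≤ 3 * matchNum H := by
    have : (0 : ℝ) ≤ R.card := Nat.cast_nonneg _
    nlinarith
  have htotal : (matchNum E : ℝ) ≤ matchNum (H ∪ U) + R.card := by
    rw [← hcard]
    exact_mod_cast hsplit.symm.le.trans (Nat.add_le_add_right hin _)
  rw [or_iff_not_imp_left]
  intro hsmall
  rw [not_le, div_mul_eq_mul_div, div_lt_iff₀ hε0] at hsmall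
  have hlow : (1 - ε) * (matchNum E : ℝ) ≤ matchNum (H ∪ U) := by linarith
  have hnonneg : (0 : ℝ) ≤ matchNum E := Nat.cast_nonneg _
  calc (matchNum E : ℝ) ≤ (1 + 2 * ε) * ((1 - ε) * matchNum E) := by
        nlinarith [mul_nonneg (mul_nonneg hε0.le (by linarith : (0 : ℝ) ≤ 1 - 2 * ε)) hnonneg]
    _ ≤ (1 + 2 * ε) * matchNum (H ∪ U) := mul_le_mul_of_nonneg_left hlow (by linarith)
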